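/- Let M be a von Neumann algebra and x an element of its closed unit ball. Then the following are equivalent: (i) x is a C*-extreme point of the unit ball of M; (ii) x is a linear extreme point of the unit ball of M; (iii) x is a strongly extreme point of the unit ball of M. In particular, every linear extreme point of the closed unit ball of a C*-algebra is a strongly extreme point. -/

import Mathlib

open Filter Topology

/-- `x` is a C*-extreme point of the closed unit ball of the von Neumann algebra `M`. -/
def IsCStarExtremePoint {H : Type*} [NormedAddCommGroup H] [InnerProductSpace ℂ H]
    [CompleteSpace H] (M : VonNeumannAlgebra H) (x : H →L[ℂ] H) : Prop :=
  x ∈ M ∧ ‖x‖ ≤ 1 ∧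
    ∀ (k : ℕ) (a t : Fin k → (H →L[ℂ] H)),
      (∀ i, a i ∈ M) → (∀ i, ‖a i‖ ≤ 1) → (∀ i, t i ∈ M) →
      (∀ i, ∃ s ∈ M, t i * s = 1 ∧ s * t i = 1) →
      (∑ i, star (t i) * t i) = 1 → x = ∑ i, star (t i) * a i * t i →
      ∀ i, ∃ u ∈ M, star u * u = 1 ∧ u * star u = 1 ∧ a i = star u * x * u

/-- `x` is a linear extreme point of the closed unit ball of `M`. -/
def IsLinExtremePoint {H : Type*} [NormedAddCommGroup H] [InnerProductSpace ℂ H]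
    [CompleteSpace H] (M : VonNeumannAlgebra H) (x : H →L[ℂ] H) : Prop :=
  x ∈ M ∧ ‖x‖ ≤ 1 ∧
    ∀ y z : H →L[ℂ] H, y ∈ M → z ∈ M → ‖y‖ ≤ 1 → ‖z‖ ≤ 1 →
      x = (2⁻¹ : ℝ) • (y + z) → y = x ∧ z = x

/-- `x` is a strongly extreme point of the closed unit ball of `M`. -/
def IsStronglyExtremePoint {H : Type*} [NormedAddCommGroup H] [InnerProductSpace ℂ H]
    [CompleteSpace H] (M : VonNeumannAlgebra H) (x : H →L[ℂ] H) : Prop :=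
  x ∈ M ∧ ‖x‖ ≤ 1 ∧
    ∀ y z : ℕ → H →L[ℂ] H, (∀ n, y n ∈ M) → (∀ n, z n ∈ M) →
      (∀ n, ‖y n‖ ≤ 1) → (∀ n, ‖z n‖ ≤ 1) →
      Tendsto (fun n => (2⁻¹ : ℝ) • (y n + z n)) atTop (𝓝 x) →
      Tendsto (fun n => ‖y n - z n‖) atTop (𝓝 0)

section CStarAlgebra

variable {A : Type*} [CStarAlgebra A]

/-- The perturbation of a partial isometry by the corner `(1 - w w⋆) a (1 - w⋆ w)`. -/
lemma star_mul_self_add_corner {w a : A} (hw : w * star w * w = w) :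
    star (w + (1 - w * star w) * a * (1 - star w * w)) *
      (w + (1 - w * star w) * a * (1 - star w * w)) = star w * w +
      star ((1 - w * star w) * a * (1 - star w * w)) *
        ((1 - w * star w) * a * (1 - star w * w)) := by
  have h1 : star w * (1 - w * star w) = 0 := by
    have := congr(star $hw)
    simp only [star_mul, star_star] at this
    rw [mul_sub, mul_one, this, sub_self]
  have h2 : (1 - w * star w) * w = 0 := by rw [sub_mul, one_mul, hw, sub_self]
  set p := 1 - w * star w with hp
  have hps : star p = p := by simp [hp]
  simp only [star_add, add_mul, mul_add, star_mul, hps]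
  have e1 : star w * (p * a * (1 - star w * w)) = 0 := by
    rw [← mul_assoc, ← mul_assoc, h1]; simp
  have e2 : star (1 - star w * w) * (star a * p) * w = 0 := by
    rw [mul_assoc, mul_assoc, h2]; simp
  rw [e1, e2]; simp

lemma exists_pos_smul_norm_le_one (a : A) : ∃ r : ℝ, 0 < r ∧ ‖r • a‖ ≤ 1 := by
  refine ⟨(‖a‖ + 1)⁻¹, by positivity, ?_⟩
  rw [norm_smul, Real.norm_of_nonneg (by positivity), inv_mul_le_iff₀ (by positivity)]
  linarith

variable [PartialOrder A] [StarOrderedRing A]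

lemma norm_le_one_iff_star_mul_self_le_one {a : A} : ‖a‖ ≤ 1 ↔ star a * a ≤ 1 := by
  rw [← CStarAlgebra.norm_le_one_iff_of_nonneg _ (star_mul_self_nonneg a),
    CStarRing.norm_star_mul_self]
  constructor
  · intro h; nlinarith [norm_nonneg a]
  · intro h; nlinarith [norm_nonneg a]

/-- An extreme point of the unit ball of a star subalgebra is a partial isometry. -/
lemma mul_star_mul_self_eq_of_extreme (S : StarSubalgebra ℂ A) {w : A} (hwS : w ∈ S)
    (hw : ‖w‖ ≤ 1)
    (hext : ∀ y z : A, y ∈ S → z ∈ S → ‖y‖ ≤ 1 → ‖z‖ ≤ 1 →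
      w = (2⁻¹ : ℝ) • (y + z) → y = w ∧ z = w) :
    w * star w * w = w := by
  set h := star w * w with hh
  have hhS : h ∈ S := mul_mem (star_mem hwS) hwS
  have hsa : star h = h := by simp [hh]
  have h1 : h ≤ 1 := norm_le_one_iff_star_mul_self_le_one.1 hw
  have hsmul : ∀ a ∈ S, (2⁻¹ : ℝ) • a ∈ S := fun a ha => by
    rw [← Complex.coe_smul]; exact S.smul_mem ha _
  set k : A := (2⁻¹ : ℝ) • (1 - h) with hk
  have hkS : k ∈ S := hsmul _ (sub_mem (one_mem _) hhS)
  have hksa : star k = k := by simp [hk, hsa]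
  have hk2 : h = 1 - (2:ℝ) • k := by rw [hk, smul_smul]; norm_num
  have hk0 : 0 ≤ k := smul_nonneg (by norm_num) (sub_nonneg.2 h1)
  have hk1 : (2:ℝ) • k ≤ 1 := by
    have : 0 ≤ h := star_mul_self_nonneg w
    rw [hk2] at this
    exact sub_nonneg.1 this
  have hy : ‖w * (1 + k)‖ ≤ 1 := by
    rw [norm_le_one_iff_star_mul_self_le_one, ← sub_nonneg]
    have e : 1 - star (w * (1 + k)) * (w * (1 + k)) = star k * ((3:ℝ) • 1 + (2:ℝ) • k) * k := by
      have : star (w * (1 + k)) * (w * (1 + k)) = (1 + k) * h * (1 + k) := by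
        simp only [star_mul, star_add, star_one, hksa, hh, mul_assoc]
      rw [this, hk2, hksa]
      simp only [mul_add, add_mul, mul_sub, sub_mul, mul_one, one_mul, smul_mul_assoc,
        mul_smul_comm]
      module
    rw [e]
    refine star_left_conjugate_nonneg ?_ _
    have : (0:A) ≤ 1 := zero_le_one
    positivity
  have hz : ‖w * (1 - k)‖ ≤ 1 := by
    have hk' : ‖1 - k‖ ≤ 1 := by
      have hk1' : k ≤ 1 := le_trans (by rw [two_smul]; simpa using hk0) hk1
      rw [CStarAlgebra.norm_le_one_iff_of_nonneg _ (sub_nonneg.2 hk1')]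
      simpa using hk0
    calc _ ≤ ‖w‖ * ‖1 - k‖ := norm_mul_le _ _
      _ ≤ 1 := by nlinarith [norm_nonneg w, norm_nonneg (1 - k)]
  have := (hext _ _ (mul_mem hwS (add_mem (one_mem _) hkS))
    (mul_mem hwS (sub_mem (one_mem _) hkS)) hy hz (by rw [mul_add, mul_sub, mul_one]; module)).1
  rw [mul_add, mul_one, add_eq_left, hk, mul_smul_comm, smul_eq_zero] at this
  have := this.resolve_left (by norm_num)
  rw [mul_sub, mul_one, sub_eq_zero, hh, ← mul_assoc] at this
  exact this.symm

lemma norm_add_corner_le_one {w a : A} (hw : w * star w * w = w) (ha : ‖a‖ ≤ 1) :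
    ‖w + (1 - w * star w) * a * (1 - star w * w)‖ ≤ 1 := by
  rw [norm_le_one_iff_star_mul_self_le_one, star_mul_self_add_corner hw]
  have hq : IsStarProjection (1 - star w * w) := by
    refine IsStarProjection.one_sub ⟨?_, by simp [isSelfAdjoint_iff]⟩
    rw [IsIdempotentElem, mul_assoc, ← mul_assoc w, hw]
  have hp : IsStarProjection (1 - w * star w) := by
    refine IsStarProjection.one_sub ⟨?_, by simp [isSelfAdjoint_iff]⟩
    rw [IsIdempotentElem, ← mul_assoc, hw]
  set q := 1 - star w * w with hq'
  have h1 : star ((1 - w * star w) * a) * ((1 - w * star w) * a) ≤ 1 := by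
    rw [← norm_le_one_iff_star_mul_self_le_one]
    calc _ ≤ ‖1 - w * star w‖ * ‖a‖ := norm_mul_le _ _
      _ ≤ 1 := by nlinarith [norm_nonneg a, hp.norm_le]
  have h2 := star_left_conjugate_le_conjugate h1 q
  rw [mul_one, hq.isSelfAdjoint.star_eq, hq.isIdempotentElem.eq] at h2
  rw [star_mul _ q, hq.isSelfAdjoint.star_eq]
  calc _ = star w * w + q * (star ((1 - w * star w) * a) * ((1 - w * star w) * a)) * q := by
        simp only [mul_assoc]
    _ ≤ star w * w + q := by gcongr
    _ = 1 := by rw [hq']; abel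

/-- The corner of the algebra cut out by the defect projections of an extreme point vanishes. -/
lemma corner_eq_zero_of_extreme (S : StarSubalgebra ℂ A) {w : A} (hwS : w ∈ S)
    (hw : w * star w * w = w)
    (hext : ∀ y z : A, y ∈ S → z ∈ S → ‖y‖ ≤ 1 → ‖z‖ ≤ 1 →
      w = (2⁻¹ : ℝ) • (y + z) → y = w ∧ z = w) {a : A} (haS : a ∈ S) :
    (1 - w * star w) * a * (1 - star w * w) = 0 := by
  wlog ha : ‖a‖ ≤ 1 generalizing a
  · obtain ⟨r, hr, hra⟩ := exists_pos_smul_norm_le_one a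
    have := this (a := r • a) (by rw [← Complex.coe_smul]; exact S.smul_mem haS _) hra
    rw [mul_smul_comm, smul_mul_assoc, smul_eq_zero] at this
    exact this.resolve_left hr.ne'
  have hdS : (1 - w * star w) * a * (1 - star w * w) ∈ S :=
    mul_mem (mul_mem (sub_mem (one_mem _) (mul_mem hwS (star_mem hwS))) haS)
      (sub_mem (one_mem _) (mul_mem (star_mem hwS) hwS))
  have h2 := norm_add_corner_le_one hw (a := -a) (by simpa using ha)
  have := (hext _ _ (add_mem hwS hdS) (sub_mem hwS hdS) (norm_add_corner_le_one hw ha)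
    (by simpa [sub_eq_add_neg] using h2) (by module)).1
  simpa using this

/-- A partial isometry with vanishing defect corner is strongly extreme. -/
lemma tendsto_norm_sub_of_corner_eq_zero (S : StarSubalgebra ℂ A) {w : A}
    (hw : w * star w * w = w)
    (hcorner : ∀ a ∈ S, (1 - w * star w) * a * (1 - star w * w) = 0)
    {y z : ℕ → A} (hyS : ∀ n, y n ∈ S) (hzS : ∀ n, z n ∈ S)
    (hy : ∀ n, ‖y n‖ ≤ 1) (hz : ∀ n, ‖z n‖ ≤ 1)
    (hlim : Tendsto (fun n => (2⁻¹ : ℝ) • (y n + z n)) atTop (𝓝 w)) :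
    Tendsto (fun n => ‖y n - z n‖) atTop (𝓝 0) := by
  -- the defect of the midpoint controls the squared half-difference
  have key : ∀ y z : A, ‖y‖ ≤ 1 → ‖z‖ ≤ 1 →
      star (y - z) * (y - z) ≤
        (4:ℝ) • (1 - star ((2⁻¹ : ℝ) • (y + z)) * ((2⁻¹ : ℝ) • (y + z))) := by
    intro y z hy hz
    rw [norm_le_one_iff_star_mul_self_le_one, ← sub_nonneg] at hy hz
    rw [← sub_nonneg]
    convert smul_nonneg (zero_le_two (α := ℝ)) (add_nonneg hy hz) using 1
    simp only [star_smul, star_add, star_sub, star_trivial, mul_add, add_mul, mul_sub, sub_mul,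
      smul_mul_assoc, mul_smul_comm]
    module
  have key2 : ∀ y z c : A, ‖y‖ ≤ 1 → ‖z‖ ≤ 1 → ‖(y - z) * c‖ ^ 2 ≤
      ‖star c * ((4:ℝ) • (1 - star ((2⁻¹ : ℝ) • (y + z)) * ((2⁻¹ : ℝ) • (y + z)))) * c‖ := by
    intro y z c hy hz
    rw [sq, ← CStarRing.norm_star_mul_self]
    refine CStarAlgebra.norm_le_norm_of_nonneg_of_le (star_mul_self_nonneg _) ?_
    convert star_left_conjugate_le_conjugate (key y z hy hz) c using 1
    simp only [star_mul, mul_assoc]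
  have key3 : ∀ (y z : ℕ → A) (w : A), (∀ n, ‖y n‖ ≤ 1) → (∀ n, ‖z n‖ ≤ 1) →
      w * star w * w = w →
      Tendsto (fun n => (2⁻¹ : ℝ) • (y n + z n)) atTop (𝓝 w) →
      Tendsto (fun n => (y n - z n) * (star w * w)) atTop (𝓝 0) := by
    intro y z w hy hz hw hlim
    have h0 : (star (star w * w) * ((4:ℝ) • (1 - star w * w)) * (star w * w)) = 0 := by
      have : (1 - star w * w) * (star w * w) = 0 := by
        rw [sub_mul, one_mul, mul_assoc, ← mul_assoc w, hw, sub_self]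
      rw [mul_assoc, smul_mul_assoc, this]; simp
    have h1 : Tendsto (fun n => ‖star (star w * w) * ((4:ℝ) •
        (1 - star ((2⁻¹ : ℝ) • (y n + z n)) * ((2⁻¹ : ℝ) • (y n + z n)))) * (star w * w)‖)
        atTop (𝓝 0) := by
      rw [← norm_zero (E := A), ← h0]
      exact (((((hlim.star.mul hlim).const_sub 1).const_smul (4:ℝ)).const_mul _).mul_const _).norm
    have h2 : Tendsto (fun n => ‖(y n - z n) * (star w * w)‖ ^ 2) atTop (𝓝 0) :=
      squeeze_zero (fun n => by positivity) (fun n => key2 _ _ _ (hy n) (hz n)) h1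
    rw [tendsto_zero_iff_norm_tendsto_zero]
    simpa using h2.sqrt
  have hr := key3 y z w hy hz hw hlim
  have hws : star w * star (star w) * star w = star w := by
    have := congr(star $hw)
    simpa only [star_mul, star_star, mul_assoc] using this
  have hl := key3 (fun n => star (y n)) (fun n => star (z n)) (star w) (by simpa using hy)
    (by simpa using hz) hws (by simpa using hlim.star)
  have hl' : Tendsto (fun n => (w * star w) * (y n - z n)) atTop (𝓝 0) := by
    simpa using hl.star
  have h3 := hr.add (hl'.mul_const (1 - star w * w))
  rw [zero_mul, add_zero] at h3
  rw [← tendsto_zero_iff_norm_tendsto_zero]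
  refine h3.congr fun n => ?_
  have := hcorner _ (sub_mem (hyS n) (hzS n))
  rw [sub_mul, one_mul, sub_mul, sub_eq_zero] at this
  rw [← this, mul_sub, mul_one]
  abel

end CStarAlgebra

/-- A continuous truncation of `t ↦ t ^ (-1/2)` at `1/4`, together with the positive and negative
parts of `t - 1/4`. -/
lemma exists_truncated_inv_sqrt {A : Type*} [CStarAlgebra A] [PartialOrder A] [StarOrderedRing A]
    {h : A} (h0 : 0 ≤ h) (h1 : h ≤ 1) :
    ∃ γ φ ψ : ℝ → ℝ, cfc φ h * cfc ψ h = 0 ∧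
      cfc γ h * h * cfc γ h = 1 - (4:ℝ) • cfc ψ h ∧
      h = (1/4:ℝ) • 1 - cfc ψ h + cfc φ h ∧ 0 ≤ cfc ψ h ∧
      star ((2:ℝ) • 1 - cfc γ h) * h * ((2:ℝ) • 1 - cfc γ h) ≤ 1 := by
  have hsa : IsSelfAdjoint h := .of_nonneg h0
  have hspec : ∀ t ∈ spectrum ℝ h, 0 ≤ t := fun t ht => spectrum_nonneg_of_nonneg h0 ht
  have hspec1 : ∀ t ∈ spectrum ℝ h, t ≤ 1 :=
    (le_algebraMap_iff_spectrum_le (r := (1:ℝ)) (a := h)).1 (by simpa using h1)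
  have hmax : ∀ t : ℝ, 0 < max t (1/4) := fun t => lt_max_of_lt_right (by norm_num)
  set γ : ℝ → ℝ := fun t => (√(max t (1/4)))⁻¹ with hγ
  have hγpos : ∀ t, 0 < γ t := fun t => inv_pos.2 (Real.sqrt_pos.2 (hmax t))
  have hγsq : ∀ t, γ t * γ t * max t (1/4) = 1 := fun t => by
    simp only [hγ]
    rw [← mul_inv, Real.mul_self_sqrt (hmax t).le]
    exact inv_mul_cancel₀ (hmax t).ne'
  have hγcont : Continuous γ :=
    Continuous.inv₀ (by fun_prop) fun t => (Real.sqrt_pos.2 (hmax t)).ne'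
  clear_value γ
  have hγc : ContinuousOn γ (spectrum ℝ h) := hγcont.continuousOn
  have hφc : ContinuousOn (fun t : ℝ => max (t - 1/4) 0) (spectrum ℝ h) := by fun_prop
  have hψc : ContinuousOn (fun t : ℝ => max (1/4 - t) 0) (spectrum ℝ h) := by fun_prop
  have hidc : ContinuousOn (fun t : ℝ => t) (spectrum ℝ h) := continuousOn_id
  have hid : cfc (fun t : ℝ => t) h = h := cfc_id' ℝ h
  have hconst : ∀ c : ℝ, c • (1 : A) = cfc (fun _ : ℝ => c) h := fun c => by
    rw [cfc_const c h, Algebra.algebraMap_eq_smul_one]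
  have hsandwich : ∀ f : ℝ → ℝ, ContinuousOn f (spectrum ℝ h) →
      cfc f h * h * cfc f h = cfc (fun t => f t * t * f t) h := fun f hf => by
    nth_rw 2 [← hid]
    rw [← cfc_mul f _ h hf hidc, ← cfc_mul (fun t => f t * t) f h (hf.mul hidc) hf]
  refine ⟨γ, fun t => max (t - 1/4) 0, fun t => max (1/4 - t) 0, ?_, ?_, ?_,
    cfc_nonneg fun t _ => le_max_right _ _, ?_⟩
  · rw [← cfc_mul _ _ h hφc hψc, ← cfc_const_zero ℝ h]
    refine cfc_congr fun t _ => ?_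
    rcases le_total t (1/4) with ht | ht
    · simp only [max_eq_right (sub_nonpos.2 ht), zero_mul]
    · simp only [max_eq_right (sub_nonpos.2 ht), mul_zero]
  · rw [hsandwich γ hγc, ← one_smul ℝ (1 : A), hconst, ← cfc_const_mul 4 _ h hψc,
      ← cfc_sub _ _ h (by fun_prop) (by fun_prop)]
    refine cfc_congr fun t _ => ?_
    have := hγsq t
    rcases le_total t (1/4) with ht | ht
    · rw [max_eq_right ht] at this
      simp only [max_eq_left (sub_nonneg.2 ht)]
      linear_combination 4 * t * this
    · rw [max_eq_left ht] at this
      simp only [max_eq_right (sub_nonpos.2 ht)]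
      linear_combination this
  · conv_lhs => rw [← hid]
    rw [hconst, ← cfc_sub _ _ h (by fun_prop) hψc,
      ← cfc_add h (fun t : ℝ => 1/4 - max (1/4 - t) 0) _ (by fun_prop) hφc]
    refine cfc_congr fun t _ => ?_
    rcases le_total t (1/4) with ht | ht
    · simp only [max_eq_left (sub_nonneg.2 ht), max_eq_right (sub_nonpos.2 ht)]; ring
    · simp only [max_eq_right (sub_nonpos.2 ht), max_eq_left (sub_nonneg.2 ht)]; ring
  · have e : (2:ℝ) • 1 - cfc γ h = cfc (fun t => 2 - γ t) h := by
      rw [hconst, ← cfc_sub _ _ h (by fun_prop) hγc]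
    have hs : star (cfc (fun t => 2 - γ t) h) = cfc (fun t => 2 - γ t) h :=
      (cfc_predicate (fun t => 2 - γ t) h : IsSelfAdjoint _)
    rw [e, hs, hsandwich _ (by fun_prop)]
    refine cfc_le_one _ _ fun t ht => ?_
    have h0 := hspec t ht
    have h1 := hspec1 t ht
    have hsq := hγsq t
    have hp := hγpos t
    rcases le_total t (1/4) with ht | ht
    · rw [max_eq_right ht] at hsq
      have : γ t = 2 := by nlinarith
      rw [this]; norm_num
    · rw [max_eq_left ht] at hsq
      have h4 : 1 ≤ γ t := by
        by_contra! h5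
        nlinarith [mul_pos hp hp]
      have h6 : t * γ t ≤ 1 := by nlinarith
      nlinarith

namespace VonNeumannAlgebra

variable {H : Type*} [NormedAddCommGroup H] [InnerProductSpace ℂ H] [CompleteSpace H]
  {M : VonNeumannAlgebra H}

lemma mem_of_commute {a : H →L[ℂ] H} (h : ∀ T ∈ M.commutant, a * T = T * a) : a ∈ M := by
  rw [← M.commutant_commutant, mem_commutant_iff]
  exact fun T hT => (h T hT).symm

lemma commute_of_mem_commutant {a T : H →L[ℂ] H} (ha : a ∈ M) (hT : T ∈ M.commutant) :
    Commute a T := mem_commutant_iff.1 hT a ha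

lemma complex_smul_mem {a : H →L[ℂ] H} (c : ℂ) (ha : a ∈ M) : c • a ∈ M :=
  M.toStarSubalgebra.smul_mem ha c

lemma real_smul_mem {a : H →L[ℂ] H} (c : ℝ) (ha : a ∈ M) : c • a ∈ M := by
  rw [← Complex.coe_smul]; exact complex_smul_mem _ ha

lemma cfc_real_mem {a : H →L[ℂ] H} (ha : a ∈ M) (f : ℝ → ℝ) : cfc f a ∈ M :=
  mem_of_commute fun _ hT => (commute_of_mem_commutant ha hT).cfc_real f

lemma rpow_mem {a : H →L[ℂ] H} (ha : a ∈ M) (r : ℝ) : a ^ r ∈ M :=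
  mem_of_commute fun _ hT => (commute_of_mem_commutant ha hT).cfc_nnreal _

lemma starProjection_mem {K : Submodule ℂ H} [K.HasOrthogonalProjection]
    (h : ∀ T ∈ M.commutant, ∀ ξ ∈ K, T ξ ∈ K) : K.starProjection ∈ M := by
  rw [IsStarProjection.mem_iff isStarProjection_starProjection]
  intro T hT
  rw [Submodule.range_starProjection]
  exact fun ξ hξ => h T hT ξ hξ

lemma mem_of_tendsto {S : ℕ → H →L[ℂ] H} {u : H →L[ℂ] H} (hS : ∀ n, S n ∈ M)
    (h : ∀ ξ, Tendsto (fun n => S n ξ) atTop (𝓝 (u ξ))) : u ∈ M := by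
  refine mem_of_commute fun T hT => ?_
  ext ξ
  refine tendsto_nhds_unique (h (T ξ)) ?_
  refine ((T.continuous.tendsto _).comp (h ξ)).congr fun n => ?_
  exact congr($((commute_of_mem_commutant (hS n) hT).eq.symm) ξ)

/-- The projection onto the kernel of an element of `M` lies in `M`, and commutes with
the self-adjoint operators commuting with that element. -/
lemma exists_kernel_projection {b : H →L[ℂ] H} (hb : b ∈ M) :
    ∃ e ∈ M, IsStarProjection e ∧ b * e = 0 ∧
      (∀ T, b * T = 0 → e * T = T) ∧ (∀ T, IsSelfAdjoint T → Commute b T → Commute e T) := by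
  have hK : IsClosed (LinearMap.ker (b : H →ₗ[ℂ] H) : Set H) := b.isClosed_ker
  have : CompleteSpace (LinearMap.ker (b : H →ₗ[ℂ] H)) := hK.completeSpace_coe
  set K := LinearMap.ker (b : H →ₗ[ℂ] H) with hKdef
  have hbe : b * K.starProjection = 0 := by
    ext ξ
    exact K.starProjection_apply_mem ξ
  have heT : ∀ T, b * T = 0 → K.starProjection * T = T := fun T hT => by
    ext ξ
    exact K.starProjection_eq_self_iff.2 congr($hT ξ)
  refine ⟨K.starProjection, starProjection_mem ?_, isStarProjection_starProjection, hbe, heT, ?_⟩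
  · intro T hT ξ hξ
    have h1 : b ξ = 0 := hξ
    have h2 : b (T ξ) = T (b ξ) := congr($(commute_of_mem_commutant hb hT) ξ)
    change b (T ξ) = 0
    rw [h2, h1, map_zero]
  · intro T hT hbT
    have h1 : K.starProjection * (T * K.starProjection) = T * K.starProjection :=
      heT _ (by rw [← mul_assoc, hbT.eq, mul_assoc, hbe, mul_zero])
    have h2 := congr(star $h1)
    have hs : star K.starProjection = K.starProjection :=
      (isStarProjection_starProjection (U := K)).isSelfAdjoint
    rw [star_mul, star_mul, hs, hT.star_eq, mul_assoc, h1] at h2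
    exact h2.symm

/-- Every element of the unit ball of a von Neumann algebra is the midpoint of a partial isometry
and a contraction. -/
lemma exists_partialIsometry_midpoint {x : H →L[ℂ] H} (hxM : x ∈ M) (hx : ‖x‖ ≤ 1) :
    ∃ y ∈ M, ∃ z ∈ M, ‖y‖ ≤ 1 ∧ ‖z‖ ≤ 1 ∧ x = (2⁻¹ : ℝ) • (y + z) ∧ y * star y * y = y := by
  set h := star x * x with hh
  have hhM : h ∈ M := mul_mem (star_mem hxM) hxM
  have hsa : IsSelfAdjoint h := .star_mul_self x
  obtain ⟨γ, φ, ψ, hpn, hghg, hhpn, hneg0, hk1⟩ :=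
    exists_truncated_inv_sqrt (star_mul_self_nonneg x) (norm_le_one_iff_star_mul_self_le_one.1 hx)
  rw [← hh] at hpn hghg hhpn hneg0 hk1
  set g := cfc γ h with hg
  set pos := cfc φ h with hpos
  set neg := cfc ψ h with hneg
  have hgM : g ∈ M := cfc_real_mem hhM _
  have hgsa : star g = g := (cfc_predicate γ h : IsSelfAdjoint g)
  have hposM : pos ∈ M := cfc_real_mem hhM _
  obtain ⟨e, heM, he, hpe, heT, heC⟩ := exists_kernel_projection hposM
  have hes : star e = e := he.isSelfAdjoint
  have hee : e * e = e := he.isIdempotentElem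
  have heh : e * h = h * e := heC h hsa ((Commute.refl h).cfc_real _)
  have heg : e * g = g * e := heC g (cfc_predicate γ h) (cfc_commute_cfc _ _ _)
  have hen : e * neg = neg := heT _ hpn
  set f := 1 - e with hf
  have hfP : IsStarProjection f := he.one_sub
  clear_value f g pos neg
  have hfs : star f = f := hfP.isSelfAdjoint
  have hff : f * f = f := hfP.isIdempotentElem
  have hfn : f * neg = 0 := by rw [hf, sub_mul, one_mul, hen, sub_self]
  have hfg : f * g = g * f := by rw [hf, sub_mul, mul_sub, heg]; simp
  have hfh : f * h = h * f := by rw [hf, sub_mul, mul_sub, heh]; simp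
  have hef : e * f = 0 := by rw [hf, mul_sub, mul_one, hee, sub_self]
  have hfe : f * e = 0 := by rw [hf, sub_mul, one_mul, hee, sub_self]
  have hyy : star (x * g * f) * (x * g * f) = f := by
    calc _ = f * (g * h * g) * f := by
          simp only [star_mul, hgsa, hfs, hh, mul_assoc]
      _ = f := by rw [hghg, mul_sub, mul_one, mul_smul_comm, hfn, smul_zero, sub_zero, hff]
  have hyM : x * g * f ∈ M :=
    mul_mem (mul_mem hxM hgM) (hf ▸ sub_mem (one_mem _) heM)
  refine ⟨x * g * f, hyM, (2:ℝ) • x - x * g * f, sub_mem (real_smul_mem _ hxM) hyM, ?_, ?_, ?_, ?_⟩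
  · rw [norm_le_one_iff_star_mul_self_le_one, hyy]
    exact hfP.le_one
  · rw [norm_le_one_iff_star_mul_self_le_one]
    have hz : (2:ℝ) • x - x * g * f = x * ((2:ℝ) • e + ((2:ℝ) • 1 - g) * f) := by
      have : (1 : H →L[ℂ] H) = e + f := by rw [hf]; abel
      nth_rw 1 [← mul_one x]
      rw [this]
      simp only [mul_add, sub_mul, mul_sub, add_mul, smul_mul_assoc, mul_smul_comm,
        mul_assoc, hef, hff]
      simp
      abel
    have hzz : star (x * ((2:ℝ) • e + ((2:ℝ) • 1 - g) * f)) *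
        (x * ((2:ℝ) • e + ((2:ℝ) • 1 - g) * f)) =
        e * ((4:ℝ) • h) * e + f * (star ((2:ℝ) • 1 - g) * h * ((2:ℝ) • 1 - g)) * f := by
      have hgf2 : f * ((2:ℝ) • 1 - g) = ((2:ℝ) • 1 - g) * f := by
        rw [mul_sub, sub_mul, hfg]; simp
      have c1 : e * (h * ((2:ℝ) • 1 - g) * f) = 0 := by
        rw [mul_assoc, ← hgf2, ← mul_assoc h, ← hfh]
        simp only [← mul_assoc, hef, zero_mul]
      have c2 : f * ((2:ℝ) • 1 - g) * h * e = 0 := by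
        rw [mul_assoc, ← heh, hgf2, mul_assoc, ← mul_assoc f, hfe]; simp
      have hs : star ((2:ℝ) • 1 - g) = (2:ℝ) • 1 - g := by simp [hgsa]
      calc _ = ((2:ℝ) • e + f * ((2:ℝ) • 1 - g)) * h * ((2:ℝ) • e + ((2:ℝ) • 1 - g) * f) := by
            rw [star_mul, star_add, star_mul, hs, hfs, star_smul, hes, star_trivial, hh]
            simp only [mul_assoc]
        _ = (4:ℝ) • (e * h * e) + (2:ℝ) • (e * (h * ((2:ℝ) • 1 - g) * f)) +
            (2:ℝ) • (f * ((2:ℝ) • 1 - g) * h * e) +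
              f * (((2:ℝ) • 1 - g) * h * ((2:ℝ) • 1 - g)) * f := by
            generalize (2:ℝ) • (1 : H →L[ℂ] H) - g = G
            simp only [mul_add, add_mul, smul_mul_assoc, mul_smul_comm, mul_assoc]
            module
        _ = _ := by
            rw [c1, c2, hs]; simp [mul_assoc]
    rw [hz, hzz]
    have t1 : e * ((4:ℝ) • h) * e ≤ e := by
      rw [← sub_nonneg]
      have : e - e * ((4:ℝ) • h) * e = (4:ℝ) • (star e * neg * e) := by
        have hpe' : e * pos * e = 0 := by rw [mul_assoc, hpe, mul_zero]
        rw [hhpn, hes, smul_add, smul_sub, smul_smul, mul_add, mul_sub, add_mul, sub_mul]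
        simp only [mul_smul_comm, smul_mul_assoc, mul_one, hee, hpe']
        module
      rw [this]
      exact smul_nonneg (by norm_num) (star_left_conjugate_nonneg hneg0 e)
    have t2 : f * (star ((2:ℝ) • 1 - g) * h * ((2:ℝ) • 1 - g)) * f ≤ f := by
      have := star_left_conjugate_le_conjugate hk1 f
      rwa [hfs, mul_one, hff] at this
    calc _ ≤ e + f := add_le_add t1 t2
      _ = 1 := by rw [hf]; abel
  · module
  · rw [mul_assoc, hyy, mul_assoc, hff]

/-- If `t` carries the range of the projection `e` onto the range of the projection `f`, the phase
of `t * e` is a partial isometry from `e` to `f` inheriting the intertwining relations of `t`. -/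
lemma exists_phase {t s e f : H →L[ℂ] H} (htM : t ∈ M) (heM : e ∈ M)
    (hts : t * s = 1) (hst : s * t = 1) (he : IsStarProjection e) (hf : IsStarProjection f)
    (hfte : f * (t * e) = t * e) (hesf : e * (s * f) = s * f) :
    ∃ w ∈ M, star w * w = e ∧ w * star w = f ∧
      ∀ x a, a * t = t * x → Commute e x → Commute (e * (star t * t) * e) x → a * w = w * x := by
  have hes : star e = e := he.isSelfAdjoint
  have hee : e * e = e := he.isIdempotentElem
  have hfs : star f = f := hf.isSelfAdjoint
  set b := e * (star t * t) * e + (1 - e) with hb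
  have hbM : b ∈ M := add_mem (mul_mem (mul_mem heM (mul_mem (star_mem htM) htM)) heM)
    (sub_mem (one_mem _) heM)
  have hbnn : 0 ≤ b := by
    refine add_nonneg ?_ he.one_sub.nonneg
    have := star_left_conjugate_nonneg (star_mul_self_nonneg t) e
    rwa [hes] at this
  have hstar : star t * star s = 1 := by rw [← star_mul, hst, star_one]
  have heb : e * b = e * (star t * t) * e := by
    rw [hb, mul_add, mul_sub, mul_one, hee, sub_self, add_zero]
    simp only [← mul_assoc, hee]
  have hbe : b * e = e * (star t * t) * e := by
    rw [hb, add_mul, sub_mul, one_mul, hee, sub_self, add_zero, mul_assoc _ e e, hee]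
  have hbinv : b * (s * f * star s + (1 - e)) = 1 := by
    have h1 : e * (star t * t) * e * (s * f * star s) = e := by
      have h2 : e * star t * f = e * star t := by
        have := congr(star $hfte)
        simpa only [star_mul, hes, hfs, mul_assoc] using this
      calc _ = e * star t * (t * (e * (s * f))) * star s := by simp only [mul_assoc]
        _ = e * star t * f * star s := by
          rw [hesf, ← mul_assoc t s f, hts, one_mul]
        _ = e := by rw [h2, mul_assoc, hstar, mul_one]
    have h3 : (1 - e) * (s * f * star s) = 0 := by
      rw [sub_mul, one_mul, ← mul_assoc e, hesf, sub_self]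
    have h4 : e * (star t * t) * e * (1 - e) = 0 := by
      rw [mul_sub, mul_one, mul_assoc _ e e, hee, sub_self]
    rw [hb, add_mul, mul_add, mul_add, h1, h3, h4, he.one_sub.isIdempotentElem.eq]
    abel
  have hbsa : star b = b := hbnn.isSelfAdjoint
  have hbunit : IsUnit b := by
    have hinv2 : (s * f * star s + (1 - e)) * b = 1 := by
      have := congr(star $hbinv)
      simpa [hbsa, hes, hfs, mul_assoc] using this
    exact ⟨⟨b, _, hbinv, hinv2⟩, rfl⟩
  have hbpos : IsStrictlyPositive b := hbunit.isStrictlyPositive hbnn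
  set r := b ^ (-(1/2) : ℝ) with hr
  have hrM : r ∈ M := rpow_mem hbM _
  have hrbr : r * b * r = 1 := CFC.conjugate_rpow_neg_one_half b hbpos
  have hrs : star r = r := (CFC.rpow_nonneg (a := b)).isSelfAdjoint
  have hcomm : ∀ T, Commute b T → Commute r T := fun T hT => hT.cfc_nnreal _
  have hre : r * e = e * r := (hcomm e (by rw [commute_iff_eq, heb, hbe])).eq
  clear_value r b
  have hww : star (t * e * r) * (t * e * r) = e := by
    calc _ = r * (e * (star t * t) * e) * r := by
          simp only [star_mul, hes, hrs, mul_assoc]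
      _ = e * (r * b * r) := by rw [← heb, ← mul_assoc, hre]; simp only [mul_assoc]
      _ = e := by rw [hrbr, mul_one]
  have hwe : t * e * r * e = t * e * r := by
    rw [mul_assoc, hre, ← mul_assoc, mul_assoc t, hee]
  have hfw : f * (t * e * r) = t * e * r := by rw [← mul_assoc, hfte]
  have hwf : t * e * r * (b * r * s * f) = f := by
    calc _ = t * e * (r * b * r) * s * f := by simp only [mul_assoc]
      _ = t * (e * (s * f)) := by rw [hrbr, mul_one]; simp only [mul_assoc]
      _ = f := by rw [hesf, ← mul_assoc, hts, one_mul]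
  refine ⟨t * e * r, mul_mem (mul_mem htM heM) hrM, hww, ?_, ?_⟩
  · have h1 : (t * e * r) * star (t * e * r) * f = f := by
      nth_rw 1 [← hwf]
      rw [← mul_assoc, mul_assoc _ (star _), hww, hwe, hwf]
    have h2 := congr(star $h1)
    rw [star_mul, star_mul, star_star, hfs, ← mul_assoc, hfw] at h2
    exact h2
  · intro x a hat hex hcx
    have hrx : Commute r x := hcomm x (by
      rw [hb]; exact hcx.add_left ((Commute.one_left x).sub_left hex))
    rw [← mul_assoc, ← mul_assoc, hat, mul_assoc t x e, ← hex.eq]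
    simp only [mul_assoc, hrx.eq]

lemma norm_apply_sq_eq (T : H →L[ℂ] H) (ξ : H) :
    ‖T ξ‖ ^ 2 = Complex.re (inner ℂ ((star T * T) ξ) ξ) :=
  T.apply_norm_sq_eq_inner_adjoint_left ξ

lemma cauchySeq_of_norm_sub_sq_le {E : Type*} [NormedAddCommGroup E] {v : ℕ → E}
    {ρ : ℕ → ℝ} (hρ : ∀ n, 0 ≤ ρ n)
    (h : ∀ m n, m ≤ n → ‖v n - v m‖ ^ 2 ≤ ρ m - ρ n) : CauchySeq v := by
  have hanti : Antitone ρ := fun m n hmn => by nlinarith [h m n hmn, sq_nonneg ‖v n - v m‖]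
  have hlim := tendsto_atTop_ciInf hanti ⟨0, by rintro _ ⟨n, rfl⟩; exact hρ n⟩
  set L := ⨅ n, ρ n
  have hL : ∀ n, L ≤ ρ n := fun n => ciInf_le ⟨0, by rintro _ ⟨n, rfl⟩; exact hρ n⟩ n
  refine cauchySeq_of_le_tendsto_0' (fun n => √(ρ n - L)) (fun m n hmn => ?_) ?_
  · rw [dist_comm, dist_eq_norm]
    exact Real.le_sqrt_of_sq_le ((h m n hmn).trans (by linarith [hL n]))
  · simpa using (hlim.sub_const L).sqrt

/-- A sequence of operators whose increments have telescoping squares converges pointwise. -/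
lemma exists_pointwise_limit {U Q : ℕ → H →L[ℂ] H} (hQ : ∀ n, 0 ≤ Q n)
    (h : ∀ m n, m ≤ n → star (U n - U m) * (U n - U m) = Q m - Q n) :
    ∃ u : H →L[ℂ] H, ∀ ξ, Tendsto (fun n => U n ξ) atTop (𝓝 (u ξ)) := by
  have hc : ∀ ξ, ∃ η, Tendsto (fun n => U n ξ) atTop (𝓝 η) := fun ξ => by
    refine cauchySeq_tendsto_of_complete (cauchySeq_of_norm_sub_sq_le
      (ρ := fun n => Complex.re (inner ℂ (Q n ξ) ξ)) (fun n => ?_) fun m n hmn => ?_)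
    · exact ((Q n).nonneg_iff_isPositive.1 (hQ n)).re_inner_nonneg_left ξ
    · have := norm_apply_sq_eq (U n - U m) ξ
      rw [h m n hmn] at this
      rw [← sub_apply, this]
      simp
  choose u hu using hc
  exact ⟨continuousLinearMapOfTendsto U (tendsto_pi_nhds.2 hu), hu⟩

section Isometry

variable {x : H →L[ℂ] H}

lemma star_pow_mul_pow_of_isometry (hx : star x * x = 1) (n : ℕ) : star x ^ n * x ^ n = 1 := by
  induction n with
  | zero => simp
  | succ n ih => rw [pow_succ, pow_succ', mul_assoc, ← mul_assoc (star x) x, hx, one_mul, ih]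

lemma pow_mul_star_pow_mul_of_le (hx : star x * x = 1) {m n : ℕ} (hmn : m ≤ n) :
    x ^ m * star x ^ m * (x ^ n * star x ^ n) = x ^ n * star x ^ n := by
  obtain ⟨k, rfl⟩ := Nat.exists_eq_add_of_le hmn
  calc _ = x ^ m * star x ^ m * ((x ^ m * x ^ k) * star x ^ (m + k)) := by rw [← pow_add]
    _ = x ^ m * (star x ^ m * x ^ m) * x ^ k * star x ^ (m + k) := by simp only [mul_assoc]
    _ = _ := by rw [star_pow_mul_pow_of_isometry hx, mul_one, ← pow_add]

lemma star_pow_mul_star_pow (n : ℕ) : star (x ^ n * star x ^ n) = x ^ n * star x ^ n := by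
  simp [star_pow]

/-- The projection onto the unitary part in the Wold decomposition of an isometry. -/
lemma exists_unitary_part_projection (hxM : x ∈ M)
    (hx : star x * x = 1) :
    ∃ e ∈ M, IsStarProjection e ∧
      (∀ ξ, Tendsto (fun n => (x ^ n * star x ^ n) ξ) atTop (𝓝 (e ξ))) ∧
      x * e = e * x ∧ x * star x * e = e ∧ ∀ n, x ^ n * star x ^ n * e = e := by
  have hle : ∀ {m n : ℕ}, m ≤ n →
      x ^ n * star x ^ n * (x ^ m * star x ^ m) = x ^ n * star x ^ n := fun {m n} hmn => by
    have := congr(star $(pow_mul_star_pow_mul_of_le hx hmn))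
    rwa [star_mul, star_pow_mul_star_pow, star_pow_mul_star_pow] at this
  obtain ⟨e, he⟩ := exists_pointwise_limit (U := fun n => x ^ n * star x ^ n)
    (Q := fun n => x ^ n * star x ^ n)
    (fun n => by rw [← star_pow]; exact mul_star_self_nonneg _) (fun m n hmn => by
      simp only [star_sub, star_pow_mul_star_pow, mul_sub, sub_mul, hle le_rfl, hle hmn,
        pow_mul_star_pow_mul_of_le hx hmn]
      abel)
  have hlimit : ∀ {T : H →L[ℂ] H} {a : H →L[ℂ] H},
      (∀ ξ, Tendsto (fun n => (x ^ n * star x ^ n) (a ξ)) atTop (𝓝 (T ξ))) → e * a = T :=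
    fun {T a} h => by
      ext ξ
      exact tendsto_nhds_unique (he (a ξ)) (h ξ)
  have hPe : ∀ n, x ^ n * star x ^ n * e = e := fun n => by
    ext ξ
    refine tendsto_nhds_unique (((x ^ n * star x ^ n).continuous.tendsto _).comp (he ξ))
      ((he ξ).congr' ?_)
    filter_upwards [eventually_ge_atTop n] with m hm
    exact congr($((pow_mul_star_pow_mul_of_le hx hm).symm) ξ)
  have hee : e * e = e := hlimit fun ξ => by
    refine tendsto_const_nhds.congr fun n => ?_
    exact congr($((hPe n).symm) ξ)
  have hsa : IsSelfAdjoint e := by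
    rw [ContinuousLinearMap.isSelfAdjoint_iff_isSymmetric]
    intro ξ η
    refine tendsto_nhds_unique ((he ξ).inner tendsto_const_nhds)
      ((tendsto_const_nhds.inner (he η)).congr fun n => ?_)
    have h1 : IsSelfAdjoint (x ^ n * star x ^ n) := star_pow_mul_star_pow n
    exact ((ContinuousLinearMap.isSelfAdjoint_iff_isSymmetric.1 h1) ξ η).symm
  have hxe : x * e * star x = e := by
    ext ξ
    refine tendsto_nhds_unique ((x.continuous.tendsto _).comp (he (star x ξ)))
      (((tendsto_add_atTop_iff_nat 1).2 (he ξ)).congr fun n => ?_)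
    have : x ^ (n + 1) * star x ^ (n + 1) = x * (x ^ n * star x ^ n) * star x := by
      rw [pow_succ', pow_succ]; simp only [mul_assoc]
    rw [this]; rfl
  refine ⟨e, mem_of_tendsto (fun n => mul_mem (pow_mem hxM n) (pow_mem (star_mem hxM) n)) he,
    ⟨hee, hsa⟩, he, ?_, ?_, hPe⟩
  · nth_rw 2 [← hxe]
    rw [mul_assoc, hx, mul_one]
  · simpa using hPe 1

/-- Gluing the unitary parts and the shift parts of two isometries. -/
lemma exists_wold_isometry {a e f v w : H →L[ℂ] H} (hx : star x * x = 1) (ha : star a * a = 1)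
    (he : ∀ ξ, Tendsto (fun n => (x ^ n * star x ^ n) ξ) atTop (𝓝 (e ξ)))
    (hvv : star v * v = 1 - x * star x) (hvv' : v * star v = 1 - a * star a)
    (hww : star w * w = e) (hww' : w * star w = f) (hwe : w * e = w) (haf : a * star a * f = f)
    (haw : star a * w = w * star x) :
    ∃ u : H →L[ℂ] H, star u * u = 1 ∧ ∀ ξ, Tendsto
      (fun n => (w + ∑ k ∈ Finset.range n, a ^ k * v * star x ^ k) ξ) atTop (𝓝 (u ξ)) := by
  have hvp : v * (1 - x * star x) = v := by
    have h1 : (v * (1 - x * star x) - v) = 0 := by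
      rw [← CStarRing.star_mul_self_eq_zero_iff]
      have h2 : IsStarProjection (1 - x * star x) := by
        refine IsStarProjection.one_sub ⟨?_, by simp [isSelfAdjoint_iff]⟩
        rw [IsIdempotentElem, mul_assoc, ← mul_assoc (star x), hx, one_mul]
      rw [← hvv] at h2 ⊢
      set p := star v * v
      have hps : star p = p := h2.isSelfAdjoint
      have hpp : p * p = p := h2.isIdempotentElem
      calc _ = (p - 1) * p * (p - 1) := by
            simp only [star_sub, star_mul, hps, p, mul_sub, sub_mul, mul_assoc, mul_one, one_mul]
        _ = 0 := by simp only [sub_mul, one_mul, hpp, sub_self, zero_mul]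
    exact sub_eq_zero.1 h1
  have hav : star a * v = 0 := by
    rw [← hvp, ← hvv, ← mul_assoc v, hvv', ← mul_assoc, mul_sub, ← mul_assoc, ha]
    simp
  have hvw : star v * w = 0 := by
    have h1 : w = a * star a * w := by
      nth_rw 1 [← hwe]
      rw [← hww, ← mul_assoc, hww', ← haf, mul_assoc, ← hww', mul_assoc w, hww, hwe]
    have h2 : star v * a = 0 := by simpa using congr(star $hav)
    rw [h1, ← mul_assoc, ← mul_assoc, h2]; simp
  have hawn : ∀ n, star a ^ n * w = w * star x ^ n := fun n => by
    induction n with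
    | zero => simp
    | succ n ih => rw [pow_succ, mul_assoc, haw, ← mul_assoc, ih, mul_assoc, ← pow_succ]
  set D : ℕ → H →L[ℂ] H := fun k => a ^ k * v * star x ^ k with hD
  set U : ℕ → H →L[ℂ] H := fun n => w + ∑ k ∈ Finset.range n, D k with hU
  have hUsucc : ∀ n, U (n + 1) = U n + D n := fun n => by
    simp only [hU, Finset.sum_range_succ, add_assoc]
  have hDstar : ∀ n, star (D n) = x ^ n * star v * star a ^ n := fun n => by
    simp [hD, star_pow, mul_assoc]
  have hDD : ∀ n, star (D n) * D n = x ^ n * star x ^ n - x ^ (n + 1) * star x ^ (n + 1) :=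
    fun n => by
      calc _ = x ^ n * star v * (star a ^ n * a ^ n) * v * star x ^ n := by
            rw [hDstar]; simp only [hD, mul_assoc]
        _ = x ^ n * (star v * v) * star x ^ n := by
            rw [star_pow_mul_pow_of_isometry ha]; simp only [mul_assoc, one_mul]
        _ = _ := by
            rw [hvv, pow_succ, pow_succ' (star x)]
            simp only [mul_sub, sub_mul, mul_one, mul_assoc]
  have hDD' : ∀ n k, k < n → star (D n) * D k = 0 := fun n k hkn => by
    obtain ⟨j, rfl⟩ := Nat.exists_eq_add_of_lt hkn
    have h1 : star a ^ (k + j + 1) * (a ^ k * v) = 0 := by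
      have : k + j + 1 = j + 1 + k := by ring
      rw [this, pow_add, mul_assoc, ← mul_assoc (star a ^ k), star_pow_mul_pow_of_isometry ha,
        one_mul, pow_succ, mul_assoc, hav, mul_zero]
    rw [hDstar, hD, mul_assoc, ← mul_assoc _ (a ^ k * v), h1]
    simp
  have hDU : ∀ n m, m ≤ n → star (D n) * U m = 0 := fun n m hmn => by
    rw [hU]
    simp only [mul_add, Finset.mul_sum]
    rw [Finset.sum_eq_zero fun k hk => hDD' n k (by have := Finset.mem_range.1 hk; omega),
      hDstar, mul_assoc, hawn, mul_assoc, ← mul_assoc (star v), hvw]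
    simp
  have hUD : ∀ n m, m ≤ n → star (U m) * D n = 0 := fun n m hmn => by
    simpa using congr(star $(hDU n m hmn))
  have hUU : ∀ n, star (U n) * U n = e + 1 - x ^ n * star x ^ n := fun n => by
    induction n with
    | zero => simp [hU, hww]
    | succ n ih =>
      rw [hUsucc, star_add, add_mul, mul_add (star (U n)) (U n) (D n),
        mul_add (star (D n)) (U n) (D n), ih, hUD n n le_rfl, hDU n n le_rfl, hDD]
      abel
  have hUsub : ∀ m n, m ≤ n → star (U n - U m) * (U n - U m) =
      x ^ m * star x ^ m - x ^ n * star x ^ n := fun m n hmn => by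
    induction n, hmn using Nat.le_induction with
    | base => simp
    | succ n hmn ih =>
      rw [hUsucc, add_sub_right_comm, star_add, add_mul, mul_add, mul_add, ih, hDD]
      have h1 : star (D n) * (U n - U m) = 0 := by
        rw [mul_sub, hDU n n le_rfl, hDU n m hmn, sub_zero]
      have h2 : star (U n - U m) * D n = 0 := by simpa using congr(star $h1)
      rw [h1, h2]
      abel
  obtain ⟨u, hu⟩ := exists_pointwise_limit (U := U) (Q := fun n => x ^ n * star x ^ n)
    (fun n => by rw [← star_pow]; exact mul_star_self_nonneg _) hUsub
  refine ⟨u, ?_, hu⟩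
  have hnorm : ∀ ξ, ‖u ξ‖ = ‖ξ‖ := fun ξ => by
    rw [← sq_eq_sq₀ (norm_nonneg _) (norm_nonneg _)]
    have h1 : Tendsto (fun n => ‖U n ξ‖ ^ 2) atTop (𝓝 (‖u ξ‖ ^ 2)) := (hu ξ).norm.pow 2
    have h2 : Tendsto (fun n => Complex.re (inner ℂ (e ξ + ξ - (x ^ n * star x ^ n) ξ) ξ)) atTop
        (𝓝 (Complex.re (inner ℂ (e ξ + ξ - e ξ) ξ))) :=
      (Complex.continuous_re.tendsto _).comp
        (((he ξ).const_sub (e ξ + ξ)).inner tendsto_const_nhds)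
    rw [add_sub_cancel_left] at h2
    have h3 : Complex.re (inner ℂ ξ ξ) = ‖ξ‖ ^ 2 := by
      simpa using (inner_self_eq_norm_sq (𝕜 := ℂ) ξ)
    rw [h3] at h2
    refine tendsto_nhds_unique h1 (h2.congr fun n => ?_)
    rw [norm_apply_sq_eq, hUU]
    rfl
  exact (ContinuousLinearMap.norm_map_iff_adjoint_comp_self u).1 hnorm

/-- The adjoint of a pointwise limit is the pointwise limit of the adjoints, if both exist. -/
lemma star_eq_of_tendsto {U : ℕ → H →L[ℂ] H} {u u' : H →L[ℂ] H}
    (hu : ∀ ξ, Tendsto (fun n => U n ξ) atTop (𝓝 (u ξ)))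
    (hu' : ∀ ξ, Tendsto (fun n => star (U n) ξ) atTop (𝓝 (u' ξ))) : star u = u' := by
  symm
  refine (ContinuousLinearMap.eq_adjoint_iff u' u).2 fun ξ η => ?_
  refine tendsto_nhds_unique ((hu' ξ).inner tendsto_const_nhds)
    ((tendsto_const_nhds.inner (hu η)).congr fun n => ?_)
  exact ((U n).adjoint_inner_left η ξ).symm

/-- If `t` intertwines the isometries `x` and `a`, it carries the unitary part of `x` into the
unitary part of `a`. -/
lemma unitary_part_mul_intertwiner {a e f t : H →L[ℂ] H} (ha : star a * a = 1)
    (hf : ∀ ξ, Tendsto (fun n => (a ^ n * star a ^ n) ξ) atTop (𝓝 (f ξ)))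
    (he : ∀ n, x ^ n * star x ^ n * e = e) (hat : a * t = t * x) : f * (t * e) = t * e := by
  have hatn : ∀ n, a ^ n * t = t * x ^ n := fun n =>
    ((show SemiconjBy t x a from hat.symm).pow_right n).eq.symm
  ext ξ
  refine tendsto_nhds_unique (hf _) (tendsto_const_nhds.congr fun n => ?_)
  have : a ^ n * star a ^ n * (t * e) = t * e := by
    have h1 : t * e = a ^ n * (t * star x ^ n * e) := by
      nth_rw 1 [← he n]
      simp only [← mul_assoc, hatn]
    rw [h1, mul_assoc, ← mul_assoc (star a ^ n), star_pow_mul_pow_of_isometry ha, one_mul]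
  exact congr($(this.symm) ξ)

/-- Similar isometries of a von Neumann algebra are unitarily equivalent in it. -/
lemma exists_unitary_of_similar_isometries {a t s : H →L[ℂ] H}
    (hxM : x ∈ M) (haM : a ∈ M) (htM : t ∈ M) (hsM : s ∈ M) (hx : star x * x = 1)
    (ha : star a * a = 1) (hts : t * s = 1) (hst : s * t = 1) (hat : a * t = t * x) :
    ∃ u ∈ M, star u * u = 1 ∧ u * star u = 1 ∧ a = star u * x * u := by
  obtain ⟨e, heM, he, helim, hxe, hxxe, hen⟩ := exists_unitary_part_projection hxM hx
  obtain ⟨f, hfM, hf, hflim, haf, haaf, hfn⟩ := exists_unitary_part_projection haM ha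
  have hsa : x * s = s * a := by
    calc _ = s * (t * x) * s := by rw [← mul_assoc, hst, one_mul]
      _ = s * a := by rw [← hat, mul_assoc, mul_assoc, hts, mul_one]
  have hes : star e = e := he.isSelfAdjoint
  have hfs : star f = f := hf.isSelfAdjoint
  have hexx : e * x * star x = e := by
    have := congr(star $hxxe)
    simpa only [star_mul, star_star, hes, ← mul_assoc] using this
  have hxcx : star x * (star t * t) * x = star t * t := by
    calc _ = star (t * x) * (t * x) := by simp only [star_mul, mul_assoc]
      _ = star t * (star a * a) * t := by rw [← hat]; simp only [star_mul, mul_assoc]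
      _ = _ := by rw [ha, mul_one]
  obtain ⟨w, hwM, hww, hww', hwint⟩ := exists_phase htM heM hts hst he hf
    (unitary_part_mul_intertwiner ha hflim hen hat)
    (unitary_part_mul_intertwiner hx helim hfn hsa)
  have haw : a * w = w * x := hwint x a hat hxe.symm (by
    rw [commute_iff_eq]
    calc _ = e * (star t * t) * x * e := by rw [mul_assoc _ e x, ← hxe, ← mul_assoc]
      _ = e * x * star x * (star t * t) * x * e := by rw [hexx]
      _ = e * x * (star x * (star t * t) * x) * e := by simp only [mul_assoc]
      _ = _ := by rw [hxcx, ← hxe]; simp only [mul_assoc])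
  have hp : IsStarProjection (1 - x * star x) := by
    refine IsStarProjection.one_sub ⟨?_, by simp [isSelfAdjoint_iff]⟩
    rw [IsIdempotentElem, mul_assoc, ← mul_assoc (star x), hx, one_mul]
  have hq : IsStarProjection (1 - a * star a) := by
    refine IsStarProjection.one_sub ⟨?_, by simp [isSelfAdjoint_iff]⟩
    rw [IsIdempotentElem, mul_assoc, ← mul_assoc (star a), ha, one_mul]
  have hxp : star x * (1 - x * star x) = 0 := by rw [mul_sub, ← mul_assoc, hx]; simp
  have haq : star a * (1 - a * star a) = 0 := by rw [mul_sub, ← mul_assoc, ha]; simp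
  obtain ⟨v, hvM, hvv, hvv', -⟩ := exists_phase (t := star s) (s := star t) (star_mem hsM)
    (sub_mem (one_mem _) (mul_mem hxM (star_mem hxM))) (by rw [← star_mul, hts, star_one])
    (by rw [← star_mul, hst, star_one]) hp hq
    (by
      have h1 : star a * star s = star s * star x := by rw [← star_mul, ← star_mul, hsa]
      rw [sub_mul, one_mul, sub_eq_self, mul_assoc, ← mul_assoc (star a), h1, mul_assoc, hxp]
      simp)
    (by
      have h1 : star x * star t = star t * star a := by rw [← star_mul, ← star_mul, hat]
      rw [sub_mul, one_mul, sub_eq_self, mul_assoc, ← mul_assoc (star x), h1, mul_assoc, haq]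
      simp)
  -- initial and final projections of `w`, as one-sided units
  have hee : e * e = e := he.isIdempotentElem
  have hff : f * f = f := hf.isIdempotentElem
  have hwe : w * e = w := by
    rw [← sub_eq_zero, ← CStarRing.star_mul_self_eq_zero_iff]
    calc _ = (e - 1) * (star w * w) * (e - 1) := by
          simp only [star_sub, star_mul, hes, mul_sub, sub_mul, mul_assoc, mul_one, one_mul]
      _ = 0 := by rw [hww]; simp only [sub_mul, one_mul, hee, sub_self, zero_mul]
  have hfw : f * w = w := by rw [← hww', mul_assoc, hww, hwe]
  have hwf : star w * f = star w := by simpa [hfs] using congr(star $hfw)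
  have hwa : star w * a = x * star w := by
    calc _ = star w * (f * a) := by rw [← mul_assoc, hwf]
      _ = star w * (a * w) * star w := by rw [← haf, ← hww']; simp only [mul_assoc]
      _ = e * x * star w := by rw [haw, ← hww]; simp only [mul_assoc]
      _ = x * (star w * w * star w) := by rw [← hxe, ← hww]; simp only [mul_assoc]
      _ = x * star w := by rw [mul_assoc, hww', hwf]
  have hawx : star a * w = w * star x := by simpa using congr(star $hwa)
  obtain ⟨u, huu, hu⟩ := exists_wold_isometry hx ha helim hvv hvv' hww hww' hwe haaf hawx
  obtain ⟨u', huu', hu'⟩ := exists_wold_isometry (v := star v) (w := star w) ha hx hflim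
    (by rw [star_star, hvv']) (by rw [star_star, hvv]) (by rw [star_star, hww'])
    (by rw [star_star, hww]) hwf hxxe (by simpa using congr(star $haw).symm)
  have hstar : star u = u' := star_eq_of_tendsto hu fun ξ => by
    refine (hu' ξ).congr fun n => ?_
    simp only [star_add, star_sum, star_mul, star_pow, star_star, mul_assoc]
  subst hstar
  rw [star_star] at huu'
  have hvx : v * x = 0 := by
    rw [← CStarRing.star_mul_self_eq_zero_iff, star_mul, mul_assoc, ← mul_assoc (star v), hvv,
      ← mul_assoc, hxp, zero_mul]
  have hux : u * x = a * u := by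
    ext ξ
    refine tendsto_nhds_unique ((tendsto_add_atTop_iff_nat 1).2 (hu (x ξ)))
      (((a.continuous.tendsto _).comp (hu ξ)).congr fun n => ?_)
    have : (w + ∑ k ∈ Finset.range (n + 1), a ^ k * v * star x ^ k) * x =
        a * (w + ∑ k ∈ Finset.range n, a ^ k * v * star x ^ k) := by
      rw [Finset.sum_range_succ', add_mul, add_mul, Finset.sum_mul, mul_add, Finset.mul_sum, haw]
      simp only [pow_zero, one_mul, mul_one, hvx, add_zero]
      congr 1
      refine Finset.sum_congr rfl fun k _ => ?_
      rw [pow_succ' a, pow_succ (star x), mul_assoc _ _ x, mul_assoc (star x ^ k), hx, mul_one]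
      simp only [mul_assoc]
    exact congr($(this.symm) ξ)
  have huM : u ∈ M := mem_of_tendsto (fun n => add_mem hwM (sum_mem fun k _ =>
    mul_mem (mul_mem (pow_mem haM k) hvM) (pow_mem (star_mem hxM) k))) hu
  refine ⟨star u, star_mem huM, by rw [star_star, huu'], by rw [star_star, huu], ?_⟩
  rw [star_star, hux, mul_assoc, huu', mul_one]

end Isometry

/-- If `p M q = 0`, then some central projection of `M` separates `p` from `q`. -/
lemma exists_central_projection {p q : H →L[ℂ] H} (hp : p ∈ M)
    (hpq : ∀ m ∈ M, p * m * q = 0) :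
    ∃ k ∈ M, IsStarProjection k ∧ (∀ m ∈ M, k * m = m * k) ∧ p * k = 0 ∧ k * q = q := by
  let K : Submodule ℂ H := ⨅ m : M, LinearMap.ker ((p * (m : H →L[ℂ] H) : H →L[ℂ] H) : H →ₗ[ℂ] H)
  have hmem : ∀ ξ, ξ ∈ K ↔ ∀ m ∈ M, p (m ξ) = 0 := fun ξ => by
    simp only [K, Submodule.mem_iInf, Subtype.forall]
    rfl
  have hK : IsClosed (K : Set H) := by
    simp only [K, Submodule.coe_iInf]
    exact isClosed_iInter fun m => (p * (m : H →L[ℂ] H)).isClosed_ker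
  have : CompleteSpace K := hK.completeSpace_coe
  have hcomm : K.starProjection ∈ M.commutant := by
    refine starProjection_mem fun T hT ξ hξ => ?_
    rw [commutant_commutant] at hT
    rw [hmem] at hξ ⊢
    exact fun m hm => hξ (m * T) (mul_mem hm hT)
  refine ⟨K.starProjection, starProjection_mem fun T hT ξ hξ => ?_,
    isStarProjection_starProjection, fun m hm => (mem_commutant_iff.1 hcomm m hm).symm, ?_, ?_⟩
  · rw [hmem] at hξ ⊢
    intro m hm
    have h : p (m (T ξ)) = T (p (m ξ)) :=
      congr($(commute_of_mem_commutant (mul_mem hp hm) hT) ξ)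
    rw [h, hξ m hm, map_zero]
  · ext ξ
    exact (hmem _).1 (K.starProjection_apply_mem ξ) 1 (one_mem M)
  · ext ξ
    exact K.starProjection_eq_self_iff.2 ((hmem _).2 fun m hm => congr($(hpq m hm) ξ))

/-- The coefficients of a C*-convex combination representing an isometry are isometries
similar to it. -/
lemma isometry_of_sum_eq {ι : Type*} [Fintype ι] {x : H →L[ℂ] H} {a t : ι → H →L[ℂ] H}
    (hx : star x * x = 1) (ha : ∀ i, ‖a i‖ ≤ 1) (ht : ∀ i, ∃ s, t i * s = 1)
    (htt : ∑ i, star (t i) * t i = 1) (hsum : x = ∑ i, star (t i) * a i * t i) (i : ι) :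
    star (a i) * a i = 1 ∧ a i * t i = t i * x := by
  have hd : ∀ i, 0 ≤ star (t i) * (1 - star (a i) * a i) * t i := fun i =>
    star_left_conjugate_nonneg (sub_nonneg.2 (norm_le_one_iff_star_mul_self_le_one.1 (ha i))) _
  have hc : ∀ i, 0 ≤ star (a i * t i - t i * x) * (a i * t i - t i * x) := fun i =>
    star_mul_self_nonneg _
  have hsum' : star x = ∑ i, star (t i) * star (a i) * t i := by
    conv_lhs => rw [hsum]
    simp [star_sum, mul_assoc]
  have hzero : ∑ i, (star (a i * t i - t i * x) * (a i * t i - t i * x) +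
      star (t i) * (1 - star (a i) * a i) * t i) = 0 := by
    calc _ = ∑ i, (star (t i) * t i - star (t i) * star (a i) * t i * x
          - star x * (star (t i) * a i * t i) + star x * (star (t i) * t i) * x) := by
          refine Finset.sum_congr rfl fun i _ => ?_
          simp only [star_sub, star_mul]
          noncomm_ring
      _ = 0 := by
          rw [Finset.sum_add_distrib, Finset.sum_sub_distrib, Finset.sum_sub_distrib,
            ← Finset.sum_mul, ← Finset.sum_mul, ← Finset.mul_sum, ← Finset.mul_sum, htt, ← hsum,
            ← hsum', mul_one, hx]
          abel
  have hi := (Finset.sum_eq_zero_iff_of_nonneg fun i _ => add_nonneg (hc i) (hd i)).1 hzero i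
    (Finset.mem_univ i)
  obtain ⟨h1, h2⟩ := (add_eq_zero_iff_of_nonneg (hc i) (hd i)).1 hi
  refine ⟨?_, sub_eq_zero.1 (CStarRing.star_mul_self_eq_zero_iff _ |>.1 h1)⟩
  obtain ⟨s, hs⟩ := ht i
  have h3 : star s * (star (t i) * (1 - star (a i) * a i) * t i) * s = 1 - star (a i) * a i := by
    calc _ = star (t i * s) * (1 - star (a i) * a i) * (t i * s) := by
          simp only [star_mul, mul_assoc]
      _ = _ := by rw [hs, star_one, one_mul, mul_one]
  rw [h2, mul_zero, zero_mul] at h3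
  exact (sub_eq_zero.1 h3.symm).symm

lemma exists_unitary_of_isometry_on_central {ι : Type*} [Fintype ι] {x z : H →L[ℂ] H}
    {a t : ι → H →L[ℂ] H} (hzM : z ∈ M) (hz : IsStarProjection z) (hzc : ∀ m ∈ M, z * m = m * z)
    (hxM : x ∈ M) (hxz : star x * x * z = z) (haM : ∀ i, a i ∈ M) (ha : ∀ i, ‖a i‖ ≤ 1)
    (htM : ∀ i, t i ∈ M) (ht : ∀ i, ∃ s ∈ M, t i * s = 1 ∧ s * t i = 1)
    (htt : ∑ i, star (t i) * t i = 1) (hsum : x = ∑ i, star (t i) * a i * t i) (i : ι) :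
    ∃ u ∈ M, star u * u = 1 ∧ u * star u = 1 ∧ z * a i = z * (star u * x * u) := by
  have hzs : star z = z := hz.isSelfAdjoint
  have hzz : z * z = z := hz.isIdempotentElem
  have hz1 : (1 - z) * z = 0 := by rw [sub_mul, one_mul, hzz, sub_self]
  have hz1' : z * (1 - z) = 0 := by rw [mul_sub, mul_one, hzz, sub_self]
  have hz11 : (1 - z) * (1 - z) = 1 - z := by rw [mul_sub, mul_one, hz1, sub_zero]
  have hstar : ∀ b ∈ M, star (z * b + (1 - z)) * (z * b + (1 - z)) =
      star b * b * z + (1 - z) := fun b hb => by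
    have hb' := hzc _ hb
    have hbs := hzc _ (star_mem hb)
    calc _ = (star b * z + (1 - z)) * (z * b + (1 - z)) := by simp [hzs]
      _ = star b * (z * z) * b + star b * (z * (1 - z)) + (1 - z) * z * b
          + (1 - z) * (1 - z) := by noncomm_ring
      _ = _ := by rw [hzz, hz1, hz1', hz11, mul_assoc, hb']; simp [mul_assoc]
  have hone : ∀ b : H →L[ℂ] H, z * (z * b + (1 - z)) = z * b := fun b => by
    rw [mul_add, ← mul_assoc, hzz, hz1', add_zero]
  have hM : ∀ b ∈ M, z * b + (1 - z) ∈ M := fun b hb =>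
    add_mem (mul_mem hzM hb) (sub_mem (one_mem M) hzM)
  have hx' : star (z * x + (1 - z)) * (z * x + (1 - z)) = 1 := by
    rw [hstar x hxM, hxz, add_sub_cancel]
  have ha' : ∀ i, ‖z * a i + (1 - z)‖ ≤ 1 := fun i => by
    rw [norm_le_one_iff_star_mul_self_le_one, hstar _ (haM i)]
    have h1 := star_left_conjugate_nonneg
      (sub_nonneg.2 (norm_le_one_iff_star_mul_self_le_one.1 (ha i))) z
    have h2 : star z * (1 - star (a i) * a i) * z = z - star (a i) * a i * z := by
      have h3 := hzc _ (mul_mem (star_mem (haM i)) (haM i))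
      rw [hzs, mul_sub, sub_mul, mul_one, hzz, h3, mul_assoc, hzz]
    rw [h2] at h1
    rw [← sub_nonneg]
    convert h1 using 1
    abel
  have hsum' : z * x + (1 - z) = ∑ i, star (t i) * (z * a i + (1 - z)) * t i := by
    calc _ = z * ∑ i, star (t i) * a i * t i + (1 - z) * ∑ i, star (t i) * t i := by
          rw [← hsum, htt, mul_one]
      _ = _ := by
          rw [Finset.mul_sum, Finset.mul_sum, ← Finset.sum_add_distrib]
          refine Finset.sum_congr rfl fun i _ => ?_
          have h1 := hzc _ (star_mem (htM i))
          rw [mul_add, add_mul, ← mul_assoc (star (t i)) z, ← h1, sub_mul, mul_sub, mul_one, ← h1,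
            sub_mul]
          simp only [mul_assoc, one_mul]
  obtain ⟨h1, h2⟩ := isometry_of_sum_eq hx' ha'
    (fun i => (ht i).imp fun s hs => hs.2.1) htt hsum' i
  obtain ⟨s, hsM, hts, hst⟩ := ht i
  obtain ⟨u, huM, hu1, hu2, hu⟩ := exists_unitary_of_similar_isometries (hM x hxM)
    (hM _ (haM i)) (htM i) hsM hx' h1 hts hst h2
  refine ⟨u, huM, hu1, hu2, ?_⟩
  have h3 := hzc _ (star_mem huM)
  rw [← hone (a i), hu, ← mul_assoc, ← mul_assoc, h3, mul_assoc (star u), hone, ← mul_assoc,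
    ← h3]
  simp only [mul_assoc]

lemma isCStarExtremePoint_of_corner_eq_zero {x : H →L[ℂ] H} (hxM : x ∈ M) (hx : ‖x‖ ≤ 1)
    (hcorner : ∀ a ∈ M, (1 - x * star x) * a * (1 - star x * x) = 0) :
    IsCStarExtremePoint M x := by
  refine ⟨hxM, hx, fun n a t haM ha htM ht htt hsum i => ?_⟩
  obtain ⟨k, hkM, hk, hkc, hpk, hkq⟩ := exists_central_projection
    (sub_mem (one_mem M) (mul_mem hxM (star_mem hxM))) hcorner
  have hks : star k = k := hk.isSelfAdjoint
  have hkk : k * k = k := hk.isIdempotentElem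
  have hzM : 1 - k ∈ M := sub_mem (one_mem M) hkM
  have hzc : ∀ m ∈ M, (1 - k) * m = m * (1 - k) := fun m hm => by
    rw [sub_mul, mul_sub, hkc m hm, one_mul, mul_one]
  have hxz : star x * x * (1 - k) = 1 - k := by
    rw [← hzc _ (mul_mem (star_mem hxM) hxM)]
    have : (1 - k) * (1 - star x * x) = 0 := by rw [sub_mul, one_mul, hkq, sub_self]
    rw [mul_sub, mul_one, sub_eq_zero] at this
    exact this.symm
  have hxk : star (star x) * star x * k = k := by
    rw [sub_mul, one_mul, sub_eq_zero] at hpk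
    rw [star_star, ← hpk]
  have hsum' : star x = ∑ i, star (t i) * star (a i) * t i := by
    conv_lhs => rw [hsum]
    simp [star_sum, mul_assoc]
  obtain ⟨u, huM, hu1, hu2, hu⟩ := exists_unitary_of_isometry_on_central hzM hk.one_sub hzc hxM
    hxz haM ha htM ht htt hsum i
  obtain ⟨v, hvM, hv1, hv2, hv⟩ := exists_unitary_of_isometry_on_central hkM hk hkc
    (star_mem hxM) hxk (fun i => star_mem (haM i)) (fun i => by rw [norm_star]; exact ha i)
    htM ht htt hsum' i
  have hv' : k * a i = k * (star v * x * v) := by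
    have h1 := congr(star $hv)
    simp only [star_mul, star_star, hks] at h1
    rw [← hkc _ (haM i), ← mul_assoc (star v),
      ← hkc _ (mul_mem (mul_mem (star_mem hvM) hxM) hvM)] at h1
    exact h1
  have hmul : ∀ b ∈ M, ∀ c ∈ M, ∀ b' c' : H →L[ℂ] H,
      ((1 - k) * b + k * c) * ((1 - k) * b' + k * c') = (1 - k) * (b * b') + k * (c * c') :=
    fun b hb c hc b' c' => by
      rw [hkc c hc, hzc b hb]
      calc _ = b * ((1 - k) * (1 - k)) * b' + b * ((1 - k) * k) * c' + c * (k * (1 - k)) * b'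
            + c * (k * k) * c' := by noncomm_ring
        _ = _ := by
          have h1 : (1 - k) * k = 0 := by rw [sub_mul, one_mul, hkk, sub_self]
          have h2 : k * (1 - k) = 0 := by rw [mul_sub, mul_one, hkk, sub_self]
          rw [hk.one_sub.isIdempotentElem.eq, h1, h2, hkk, ← hkc c hc, ← hzc b hb]
          simp only [mul_zero, zero_mul, add_zero, mul_assoc]
  have hsplit : ∀ b : H →L[ℂ] H, (1 - k) * b + k * b = b := fun b => by
    rw [← add_mul, sub_add_cancel, one_mul]
  have hstar : star ((1 - k) * u + k * v) = (1 - k) * star u + k * star v := by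
    rw [star_add, star_mul, star_mul, star_sub, star_one, hks, hkc _ (star_mem hvM),
      hzc _ (star_mem huM)]
  refine ⟨(1 - k) * u + k * v, add_mem (mul_mem hzM huM) (mul_mem hkM hvM), ?_, ?_, ?_⟩
  · rw [hstar, hmul _ (star_mem huM) _ (star_mem hvM), hu1, hv1, hsplit]
  · rw [hstar, hmul _ huM _ hvM, hu2, hv2, hsplit]
  · rw [hstar]
    conv_rhs => rw [← hsplit x]
    rw [hmul _ (star_mem huM) _ (star_mem hvM), hmul _ (mul_mem (star_mem huM) hxM) _
      (mul_mem (star_mem hvM) hxM), ← hu, ← hv', hsplit]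

lemma exists_unitary_of_midpoint {x y z : H →L[ℂ] H} (hext : IsCStarExtremePoint M x)
    (hyM : y ∈ M) (hzM : z ∈ M) (hy : ‖y‖ ≤ 1) (hz : ‖z‖ ≤ 1) (hxyz : x = (2⁻¹ : ℝ) • (y + z)) :
    ∃ u ∈ M, star u * u = 1 ∧ u * star u = 1 ∧ y = star u * x * u := by
  have h2 : (√2 : ℝ)⁻¹ * (√2)⁻¹ = 2⁻¹ := by rw [← mul_inv, Real.mul_self_sqrt (by norm_num)]
  have hs2 : (√2 : ℝ) ≠ 0 := by positivity
  refine hext.2.2 2 ![y, z] (fun _ => (√2 : ℝ)⁻¹ • 1) (by simp [Fin.forall_fin_two, hyM, hzM])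
    (by simp [Fin.forall_fin_two, hy, hz]) (fun _ => real_smul_mem _ (one_mem M))
    (fun _ => ⟨(√2 : ℝ) • 1, real_smul_mem _ (one_mem M), ?_, ?_⟩) ?_ ?_ 0
  · rw [smul_mul_smul_comm, inv_mul_cancel₀ hs2, one_smul, one_mul]
  · rw [smul_mul_smul_comm, mul_inv_cancel₀ hs2, one_smul, one_mul]
  · simp only [star_smul, star_trivial, star_one, smul_mul_smul_comm, h2, one_mul,
      Fin.sum_univ_two, ← add_smul]
    norm_num
  · simp only [star_smul, star_trivial, star_one, smul_mul_assoc, mul_smul_comm, smul_smul, h2,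
      one_mul, mul_one, Fin.sum_univ_two, ← smul_add]
    exact hxyz

lemma mul_star_mul_self_iff_of_unitary {x y u : H →L[ℂ] H}
    (hu' : u * star u = 1) (hy : y = star u * x * u) :
    y * star y * y = y ↔ x * star x * x = x := by
  have h1 : y * star y * y = star u * (x * star x * x) * u := by
    calc _ = star u * x * (u * star u) * star x * (u * star u) * x * u := by
          rw [hy]; simp only [star_mul, star_star, mul_assoc]
      _ = _ := by rw [hu']; simp only [mul_one, mul_assoc]
  have h2 : ∀ b : H →L[ℂ] H, u * (star u * b * u) * star u = b := fun b => by
    calc _ = (u * star u) * b * (u * star u) := by simp only [mul_assoc]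
      _ = b := by rw [hu', one_mul, mul_one]
  rw [h1, hy]
  refine ⟨fun h => ?_, fun h => by rw [h]⟩
  rw [← h2 (x * star x * x), h, h2]

lemma mul_star_mul_self_eq_of_isCStarExtremePoint {x : H →L[ℂ] H}
    (hext : IsCStarExtremePoint M x) : x * star x * x = x := by
  obtain ⟨y, hyM, z, hzM, hy, hz, hxyz, hyy⟩ := exists_partialIsometry_midpoint hext.1 hext.2.1
  obtain ⟨u, -, -, hu', hyu⟩ := exists_unitary_of_midpoint hext hyM hzM hy hz hxyz
  exact (mul_star_mul_self_iff_of_unitary hu' hyu).1 hyy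

lemma corner_eq_zero_of_isCStarExtremePoint {x a : H →L[ℂ] H} (hext : IsCStarExtremePoint M x)
    (haM : a ∈ M) : (1 - x * star x) * a * (1 - star x * x) = 0 := by
  have hw := mul_star_mul_self_eq_of_isCStarExtremePoint hext
  wlog ha : ‖a‖ ≤ 1 generalizing a
  · obtain ⟨r, hr, hra⟩ := exists_pos_smul_norm_le_one a
    have := this (a := r • a) (real_smul_mem _ haM) hra
    rw [mul_smul_comm, smul_mul_assoc, smul_eq_zero] at this
    exact this.resolve_left hr.ne'
  have hpM : 1 - x * star x ∈ M := sub_mem (one_mem M) (mul_mem hext.1 (star_mem hext.1))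
  have hqM : 1 - star x * x ∈ M := sub_mem (one_mem M) (mul_mem (star_mem hext.1) hext.1)
  have hidem : ∀ b ∈ M, ‖b‖ ≤ 1 → ∀ d, d = (1 - x * star x) * b * (1 - star x * x) →
      star d * d * (star d * d) = star d * d := fun b hbM hb d hd => by
    have hdM : d ∈ M := hd ▸ mul_mem (mul_mem hpM hbM) hqM
    have hadd := norm_add_corner_le_one hw hb
    have hsub := norm_add_corner_le_one (a := -b) hw (by rwa [norm_neg])
    have hstar := star_mul_self_add_corner (a := b) hw
    rw [mul_neg, neg_mul] at hsub
    rw [← hd] at hadd hsub hstar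
    obtain ⟨u, -, -, hu', hyu⟩ := exists_unitary_of_midpoint hext (add_mem hext.1 hdM)
      (add_mem hext.1 (neg_mem hdM)) hadd hsub (by module)
    have hy := (mul_star_mul_self_iff_of_unitary hu' hyu).2 hw
    have hPP : (star x * x + star d * d) * (star x * x + star d * d) =
        star x * x + star d * d := by
      rw [← hstar, mul_assoc, ← mul_assoc (x + d), hy]
    have hqx : (1 - star x * x) * star x = 0 := by
      have := congr(star $hw)
      simp only [star_mul, star_star] at this
      rw [sub_mul, one_mul, mul_assoc, this, sub_self]
    have hdx : d * star x = 0 := by rw [hd, mul_assoc, hqx, mul_zero]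
    have hxd : x * star d = 0 := by simpa using congr(star $hdx)
    have hxx : star x * x * (star x * x) = star x * x := by
      rw [mul_assoc, ← mul_assoc x, hw]
    have h1 : star x * x * (star d * d) = 0 := by
      rw [mul_assoc, ← mul_assoc x, hxd, zero_mul, mul_zero]
    have h2 : star d * d * (star x * x) = 0 := by
      rw [mul_assoc, ← mul_assoc d, hdx, zero_mul, mul_zero]
    rw [add_mul, mul_add, mul_add, hxx, h1, h2, add_zero, zero_add] at hPP
    exact add_left_cancel hPP
  set d := (1 - x * star x) * a * (1 - star x * x) with hd
  have h1 := hidem a haM ha d hd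
  have h2 := hidem ((2⁻¹ : ℝ) • a) (real_smul_mem _ haM)
    (by rw [norm_smul]; norm_num; linarith) ((2⁻¹ : ℝ) • d)
    (by rw [mul_smul_comm, smul_mul_assoc])
  simp only [star_smul, star_trivial, smul_mul_smul_comm, h1] at h2
  rw [← sub_eq_zero, ← sub_smul, smul_eq_zero] at h2
  exact (CStarRing.star_mul_self_eq_zero_iff _).1 (h2.resolve_left (by norm_num))

lemma mul_star_mul_self_eq_of_isLinExtremePoint {x : H →L[ℂ] H} (hext : IsLinExtremePoint M x) :
    x * star x * x = x :=
  mul_star_mul_self_eq_of_extreme M.toStarSubalgebra hext.1 hext.2.1 hext.2.2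

lemma corner_eq_zero_of_isLinExtremePoint {x a : H →L[ℂ] H} (hext : IsLinExtremePoint M x)
    (haM : a ∈ M) : (1 - x * star x) * a * (1 - star x * x) = 0 :=
  corner_eq_zero_of_extreme M.toStarSubalgebra hext.1
    (mul_star_mul_self_eq_of_isLinExtremePoint hext) hext.2.2 haM

lemma isStronglyExtremePoint_of_corner_eq_zero {x : H →L[ℂ] H} (hxM : x ∈ M) (hx : ‖x‖ ≤ 1)
    (hw : x * star x * x = x)
    (hcorner : ∀ a ∈ M, (1 - x * star x) * a * (1 - star x * x) = 0) :
    IsStronglyExtremePoint M x :=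
  ⟨hxM, hx, fun _ _ hyM hzM hy hz hlim =>
    tendsto_norm_sub_of_corner_eq_zero M.toStarSubalgebra hw hcorner hyM hzM hy hz hlim⟩

lemma isLinExtremePoint_of_isStronglyExtremePoint {x : H →L[ℂ] H}
    (hext : IsStronglyExtremePoint M x) : IsLinExtremePoint M x := by
  refine ⟨hext.1, hext.2.1, fun y z hyM hzM hy hz hxyz => ?_⟩
  have h := hext.2.2 (fun _ => y) (fun _ => z) (fun _ => hyM) (fun _ => hzM) (fun _ => hy)
    (fun _ => hz) (by rw [hxyz]; exact tendsto_const_nhds)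
  have hyz : y = z := sub_eq_zero.1 (norm_eq_zero.1 (tendsto_nhds_unique tendsto_const_nhds h))
  subst hyz
  have : x = y := by rw [hxyz]; module
  exact ⟨this.symm, this.symm⟩

end VonNeumannAlgebra

/-- A linear extreme point of the unit ball of a unital C*-algebra is strongly extreme. -/
lemma tendsto_norm_sub_of_extreme {A : Type*} [CStarAlgebra A] {w : A} (hw : ‖w‖ ≤ 1)
    (hext : ∀ y z : A, ‖y‖ ≤ 1 → ‖z‖ ≤ 1 → w = (2⁻¹ : ℝ) • (y + z) → y = w ∧ z = w)
    {y z : ℕ → A} (hy : ∀ n, ‖y n‖ ≤ 1) (hz : ∀ n, ‖z n‖ ≤ 1)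
    (hlim : Tendsto (fun n => (2⁻¹ : ℝ) • (y n + z n)) atTop (𝓝 w)) :
    Tendsto (fun n => ‖y n - z n‖) atTop (𝓝 0) := by
  let := CStarAlgebra.spectralOrder A
  have := CStarAlgebra.spectralOrderedRing A
  have hext' : ∀ y z : A, y ∈ (⊤ : StarSubalgebra ℂ A) → z ∈ (⊤ : StarSubalgebra ℂ A) →
      ‖y‖ ≤ 1 → ‖z‖ ≤ 1 → w = (2⁻¹ : ℝ) • (y + z) → y = w ∧ z = w :=
    fun y z _ _ => hext y z
  have hww := mul_star_mul_self_eq_of_extreme ⊤ trivial hw hext'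
  exact tendsto_norm_sub_of_corner_eq_zero ⊤ hww
    (fun a ha => corner_eq_zero_of_extreme ⊤ trivial hww hext' ha)
    (fun _ => trivial) (fun _ => trivial) hy hz hlim

/-- Theorem B: for an element `x` of the closed unit ball of a von Neumann algebra `M`,
C*-extremality, linear extremality and strong extremality coincide. In particular,
every linear extreme point of the closed unit ball of a unital C*-algebra is a
strongly extreme point. -/
theorem cstarExtreme_iff_linExtreme_iff_stronglyExtreme {H : Type*}
    [NormedAddCommGroup H] [InnerProductSpace ℂ H] [CompleteSpace H]
    (M : VonNeumannAlgebra H) (x : H →L[ℂ] H) (hxM : x ∈ M) (hx : ‖x‖ ≤ 1) :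
    (IsCStarExtremePoint M x ↔ IsLinExtremePoint M x) ∧
    (IsLinExtremePoint M x ↔ IsStronglyExtremePoint M x) ∧
    (∀ (A : Type*) [NormedRing A] [StarRing A] [CStarRing A] [NormedAlgebra ℂ A]
      [CompleteSpace A] [StarModule ℂ A] (w : A), ‖w‖ ≤ 1 →
      (∀ y z : A, ‖y‖ ≤ 1 → ‖z‖ ≤ 1 → w = (2⁻¹ : ℝ) • (y + z) → y = w ∧ z = w) →
      ∀ y z : ℕ → A, (∀ n, ‖y n‖ ≤ 1) → (∀ n, ‖z n‖ ≤ 1) →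
        Tendsto (fun n => (2⁻¹ : ℝ) • (y n + z n)) atTop (𝓝 w) →
        Tendsto (fun n => ‖y n - z n‖) atTop (𝓝 0)) := by
  refine ⟨⟨fun h => ?_, fun h => ?_⟩, ⟨fun h => ?_, fun h => ?_⟩, ?_⟩
  · exact VonNeumannAlgebra.isLinExtremePoint_of_isStronglyExtremePoint
      (VonNeumannAlgebra.isStronglyExtremePoint_of_corner_eq_zero hxM hx
        (VonNeumannAlgebra.mul_star_mul_self_eq_of_isCStarExtremePoint h)
        fun _ => VonNeumannAlgebra.corner_eq_zero_of_isCStarExtremePoint h)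
  · exact VonNeumannAlgebra.isCStarExtremePoint_of_corner_eq_zero hxM hx
      fun _ => VonNeumannAlgebra.corner_eq_zero_of_isLinExtremePoint h
  · exact VonNeumannAlgebra.isStronglyExtremePoint_of_corner_eq_zero hxM hx
      (VonNeumannAlgebra.mul_star_mul_self_eq_of_isLinExtremePoint h)
      fun _ => VonNeumannAlgebra.corner_eq_zero_of_isLinExtremePoint h
  · exact VonNeumannAlgebra.isLinExtremePoint_of_isStronglyExtremePoint h
  · intro A _ _ _ _ _ _ w hw hext y z hy hz hlim
    let : CStarAlgebra A := {}
    exact tendsto_norm_sub_of_extreme hw hext hy hz hlim
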